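/- Let ζ = ξ + iη with ξ, η ∈ ℝ, −1/2 < ξ < 0, η ≠ 0, and let μ be an odd integer. Set c(ξ) = π^{1/2}·2^{−2ξ}·Γ(−ξ)/Γ(1/2+ξ). Then the double integral below converges absolutely and (1/c(ξ))·∬_{ℝ×ℝ} f_{ζ,μ}(t)·f_{conj(ζ),−μ}(u)·|t−u|^{−2ξ−1} dt du = 2^{2ξ}·Re[ (Γ(1/2+conj(ζ)+μ/2)/Γ(1/2−ζ+μ/2))·(1 + i·tan(πξ)·coth(πη)) ]. -/

import Mathlib

open MeasureTheory

/-- `f_{ζ,μ}(t) = π^{-1/2}(1+it)^{ζ-1/2+μ/2}(1-it)^{ζ-1/2-μ/2}` (principal branch powers). -/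
noncomputable def fz (ζ : ℂ) (μ : ℤ) (t : ℝ) : ℂ :=
  (Real.pi : ℂ) ^ (-(1/2) : ℂ) * ((1 : ℂ) + (t : ℂ) * Complex.I) ^ (ζ - 1/2 + (μ : ℂ)/2) *
    ((1 : ℂ) - (t : ℂ) * Complex.I) ^ (ζ - 1/2 - (μ : ℂ)/2)

/-- Laplace transform of a power function at a complex rate. -/
theorem integrableOn_cpow_mul_exp_neg_mul {p r : ℂ} (hp : 0 < p.re) (hr : 0 < r.re) :
    IntegrableOn (fun t : ℝ => (t : ℂ) ^ (p - 1) * Complex.exp (-(r * t))) (Set.Ioi 0) := by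
  have h := Real.GammaIntegral_convergent hp
  have h2 : IntegrableOn (fun t : ℝ => t ^ (p.re - 1) * Real.exp (-r.re * t)) (Set.Ioi 0) :=
    integrableOn_rpow_mul_exp_neg_mul_rpow (s := p.re - 1) (p := 1) (b := r.re) (by linarith)
      one_pos hr |>.congr_fun (fun t _ => by simp) measurableSet_Ioi
  refine Integrable.mono' h2 ?_ ?_
  · refine ContinuousOn.aestronglyMeasurable ?_ measurableSet_Ioi
    refine ContinuousOn.mul (fun t ht => ?_) (by fun_prop)
    exact (Complex.continuousAt_ofReal_cpow_const t (p - 1) (Or.inr (ne_of_gt ht))).continuousWithinAt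
  · filter_upwards [ae_restrict_mem measurableSet_Ioi] with t ht
    rw [norm_mul, Complex.norm_cpow_eq_rpow_re_of_pos ht, Complex.norm_exp]
    simp

theorem integral_cpow_mul_exp_neg_complex_mul {p r : ℂ} (hp : 0 < p.re) (hr : 0 < r.re) :
    ∫ t : ℝ in Set.Ioi 0, (t : ℂ) ^ (p - 1) * Complex.exp (-(r * t)) =
      r ^ (-p) * Complex.Gamma p := by
  have hopen : IsOpen {z : ℂ | 0 < z.re} := isOpen_lt continuous_const Complex.continuous_re
  have hL : AnalyticOnNhd ℂ (fun r : ℂ => ∫ t : ℝ in Set.Ioi 0,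
      (t : ℂ) ^ (p - 1) * Complex.exp (-(r * t))) {z : ℂ | 0 < z.re} := by
    refine DifferentiableOn.analyticOnNhd (fun z hz => ?_) hopen
    have hz' : (0 : ℝ) < z.re := hz
    have h_int : IntegrableOn (fun t : ℝ => (t : ℂ) ^ (p + 1 - 1) *
        Complex.exp (-((z.re / 2 : ℝ) * t))) (Set.Ioi 0) :=
      integrableOn_cpow_mul_exp_neg_mul (by simp; linarith) (by rw [Complex.ofReal_re]; linarith)
    refine ((hasDerivAt_integral_of_dominated_loc_of_deriv_le
      (μ := volume.restrict (Set.Ioi (0 : ℝ))) (s := {w : ℂ | z.re / 2 < w.re})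
      (bound := fun t : ℝ => ‖(t : ℂ) ^ (p + 1 - 1) * Complex.exp (-((z.re / 2 : ℝ) * t))‖)
      (F := fun r (t : ℝ) => (t : ℂ) ^ (p - 1) * Complex.exp (-(r * t)))
      (F' := fun r (t : ℝ) => (t : ℂ) ^ (p - 1) * (Complex.exp (-(r * t)) * (-t)))
      (x₀ := z) ?_ ?_ ?_ ?_ ?_ ?_ ?_).2.differentiableAt).differentiableWithinAt
    · exact (isOpen_lt continuous_const Complex.continuous_re).mem_nhds
        (by simp only [Set.mem_ofPred_eq]; linarith)
    · filter_upwards [hopen.mem_nhds hz] with w hw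
      exact (integrableOn_cpow_mul_exp_neg_mul hp hw).aestronglyMeasurable
    · exact integrableOn_cpow_mul_exp_neg_mul hp hz'
    · have := (integrableOn_cpow_mul_exp_neg_mul hp hz').aestronglyMeasurable
      have h2 := this.mul (g := fun t : ℝ => (-t : ℂ)) (by fun_prop)
      refine h2.congr (Filter.Eventually.of_forall fun t => ?_)
      simp only [Pi.mul_apply]; ring
    · filter_upwards [ae_restrict_mem measurableSet_Ioi] with t ht w hw
      have ht' : (0 : ℝ) < t := ht
      have hw' : z.re / 2 < w.re := hw
      rw [norm_mul, norm_mul, norm_mul, Complex.norm_cpow_eq_rpow_re_of_pos ht,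
        Complex.norm_cpow_eq_rpow_re_of_pos ht, Complex.norm_exp, Complex.norm_exp, norm_neg,
        Complex.norm_real, Real.norm_of_nonneg ht'.le]
      have e : t ^ (p + 1 - 1).re = t ^ (p - 1).re * t := by
        rw [← Real.rpow_add_one ht'.ne']; simp
      rw [e, mul_assoc, mul_comm (Real.exp _) t]
      refine mul_le_mul_of_nonneg_left (mul_le_mul_of_nonneg_left (Real.exp_le_exp.2 ?_) ht'.le)
        (by positivity)
      simp only [Complex.neg_re, Complex.mul_re, Complex.ofReal_re, Complex.ofReal_im, mul_zero,
        sub_zero]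
      nlinarith
    · exact h_int.norm
    · filter_upwards with t w hw
      have h1 : HasDerivAt (fun w : ℂ => -(w * (t : ℂ))) (-(t : ℂ)) w := by
        have h := (hasDerivAt_mul_const (x := w) (t : ℂ)).neg
        exact h
      exact (h1.cexp).const_mul _
  have hR : AnalyticOnNhd ℂ (fun r : ℂ => r ^ (-p) * Complex.Gamma p) {z : ℂ | 0 < z.re} := by
    refine DifferentiableOn.analyticOnNhd (fun z hz => ?_) hopen
    have : DifferentiableAt ℂ (fun r : ℂ => r ^ (-p)) z :=
      differentiableAt_id.cpow_const (Or.inl hz)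
    exact (this.mul_const _).differentiableWithinAt
  have hconn : IsPreconnected {z : ℂ | 0 < z.re} := (convex_halfSpace_re_gt 0).isPreconnected
  refine hL.eqOn_of_preconnected_of_frequently_eq hR hconn (z₀ := 1) (by simp) ?_ hr
  have ht : Filter.Tendsto (fun n : ℕ => (((1 + 1 / ((n : ℝ) + 1) : ℝ)) : ℂ)) Filter.atTop
      (nhdsWithin 1 {1}ᶜ) := by
    refine tendsto_nhdsWithin_iff.2 ⟨?_, Filter.Eventually.of_forall fun n => ?_⟩
    · have h := (tendsto_one_div_add_atTop_nhds_zero_nat (𝕜 := ℝ)).const_add 1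
      rw [add_zero] at h
      exact (Complex.continuous_ofReal.tendsto' (1 : ℝ) 1 (by simp)).comp h
    · have : (0 : ℝ) < 1 / ((n : ℝ) + 1) := by positivity
      simp only [Set.mem_compl_iff, Set.mem_singleton_iff]
      intro h
      have := congrArg Complex.re h
      simp only [Complex.ofReal_re, Complex.one_re] at this
      linarith
  refine ht.frequently (Filter.Frequently.of_forall fun n => ?_)
  have hpos : (0 : ℝ) < 1 + 1 / ((n : ℝ) + 1) := by positivity
  rw [Complex.integral_cpow_mul_exp_neg_mul_Ioi hp hpos, one_div, Complex.inv_cpow,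
    Complex.cpow_neg]
  rw [Complex.arg_ofReal_of_nonneg hpos.le]
  exact Real.pi_pos.ne

open FourierTransform in
/-- Parseval's identity in the form `∫ 𝓕 f(w) 𝓕 g(-w) dw = ∫ f g`. -/
theorem integral_fourier_mul_fourier_neg {f g : ℝ → ℂ} (hf : Integrable f) (hg : Integrable g)
    (hgc : Continuous g) (hg' : Integrable (𝓕 g)) :
    ∫ w, 𝓕 f w * 𝓕 g (-w) = ∫ s, f s * g s := by
  have hi : Integrable (fun w => 𝓕 g (-w)) := hg'.comp_neg
  have h := VectorFourier.integral_fourierIntegral_smul_eq_flip (L := innerₗ ℝ)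
      Real.continuous_fourierChar continuous_inner hf hi
  have h2 : 𝓕 (fun w => 𝓕 g (-w)) = g := by
    have : (fun w => 𝓕 g (-w)) = 𝓕⁻ g := by
      ext w; rw [Real.fourierInv_eq_fourier_neg]
    rw [this]
    exact hgc.fourier_fourierInv_eq hg hg'
  have h3 : ∀ x, VectorFourier.fourierIntegral Real.fourierChar volume (innerₗ ℝ).flip
      (fun w => 𝓕 g (-w)) x = g x := fun x => by
    rw [← congrFun h2 x, flip_innerₗ]
    rfl
  simp only [h3, smul_eq_mul] at h
  exact h

/-- The one-sided Gamma density `s^{p-1} e^{-2π c s}` on `s > 0`. -/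
noncomputable def gammaKernel (p c : ℂ) : ℝ → ℂ :=
  (Set.Ioi (0 : ℝ)).indicator fun s => (s : ℂ) ^ (p - 1) * Complex.exp (-(2 * Real.pi * c * s))

theorem integrable_gammaKernel {p c : ℂ} (hp : 0 < p.re) (hc : 0 < c.re) :
    Integrable (gammaKernel p c) := by
  refine (integrable_indicator_iff measurableSet_Ioi).2 ?_
  refine integrableOn_cpow_mul_exp_neg_mul hp ?_
  have := Real.pi_pos
  simp
  positivity

theorem integral_gammaKernel {p c : ℂ} (hp : 0 < p.re) (hc : 0 < c.re) :
    ∫ s, gammaKernel p c s = (2 * Real.pi * c) ^ (-p) * Complex.Gamma p := by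
  rw [gammaKernel, integral_indicator measurableSet_Ioi]
  refine integral_cpow_mul_exp_neg_complex_mul hp ?_
  have := Real.pi_pos
  simp
  positivity

open FourierTransform in
theorem fourier_gammaKernel {p c : ℂ} (hp : 0 < p.re) (hc : 0 < c.re) (w : ℝ) :
    𝓕 (gammaKernel p c) w =
      (2 * Real.pi * (c + w * Complex.I)) ^ (-p) * Complex.Gamma p := by
  rw [Real.fourier_real_eq_integral_exp_smul, ← integral_gammaKernel hp (by simpa using hc)]
  congr 1
  ext s
  by_cases hs : s ∈ Set.Ioi (0 : ℝ)
  · simp only [gammaKernel, Set.indicator_of_mem hs, smul_eq_mul]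
    rw [mul_left_comm, ← Complex.exp_add]
    congr 2
    push_cast
    ring
  · simp only [gammaKernel, Set.indicator_of_notMem hs, smul_zero]

theorem continuous_gammaKernel {p c : ℂ} (hp : 1 < p.re) : Continuous (gammaKernel p c) := by
  have h : gammaKernel p c = fun s : ℝ => ((max s 0 : ℝ) : ℂ) ^ (p - 1) *
      Complex.exp (-(2 * Real.pi * c * s)) := by
    ext s
    by_cases hs : s ∈ Set.Ioi (0 : ℝ)
    · rw [gammaKernel, Set.indicator_of_mem hs, max_eq_left (le_of_lt hs)]
    · have h0 : p - 1 ≠ 0 := fun h => by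
        have := congrArg Complex.re h
        simp at this
        linarith
      rw [gammaKernel, Set.indicator_of_notMem hs, max_eq_right (not_lt.1 hs),
        Complex.ofReal_zero, Complex.zero_cpow h0, zero_mul]
  rw [h]
  refine Continuous.mul ?_ (by fun_prop)
  exact (Complex.continuous_ofReal_cpow_const (by simpa using hp)).comp
    (continuous_id.max continuous_const)

theorem two_pi_mul_cpow (z p : ℂ) (hz : z ≠ 0) :
    (2 * Real.pi * z) ^ p = ((2 * Real.pi : ℂ)) ^ p * z ^ p := by
  have h : (0 : ℝ) < 2 * Real.pi := by positivity
  have h2 : (2 * Real.pi : ℂ) = ((2 * Real.pi : ℝ) : ℂ) := by push_cast; rfl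
  have h3 : ((2 * Real.pi : ℝ) : ℂ) ≠ 0 := by exact_mod_cast h.ne'
  rw [h2, Complex.cpow_def_of_ne_zero (mul_ne_zero h3 hz), Complex.cpow_def_of_ne_zero h3,
    Complex.cpow_def_of_ne_zero hz, Complex.log_ofReal_mul h hz, Complex.ofReal_log h.le,
    ← Complex.exp_add]
  ring_nf

theorem log_one_add_mul_I (t : ℝ) :
    Complex.log (1 + t * Complex.I) =
      ((1 / 2 * Real.log (1 + t ^ 2) : ℝ) : ℂ) + (Real.arctan t : ℂ) * Complex.I := by
  have h0 : (0 : ℝ) < 1 + t ^ 2 := by positivity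
  have hs : (0 : ℝ) < Real.sqrt (1 + t ^ 2) := Real.sqrt_pos.2 h0
  have key : (1 : ℂ) + t * Complex.I = (Real.sqrt (1 + t ^ 2) : ℂ) *
      (Complex.cos (Real.arctan t : ℝ) + Complex.sin (Real.arctan t : ℝ) * Complex.I) := by
    rw [← Complex.ofReal_cos, ← Complex.ofReal_sin, Real.cos_arctan, Real.sin_arctan]
    have : (Real.sqrt (1 + t ^ 2) : ℂ) ≠ 0 := by exact_mod_cast hs.ne'
    push_cast
    field_simp
  have harg : Complex.arg (1 + t * Complex.I) = Real.arctan t := by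
    rw [key]
    refine Complex.arg_mul_cos_add_sin_mul_I hs ⟨?_, ?_⟩
    · linarith [Real.neg_pi_div_two_lt_arctan t, Real.pi_pos]
    · linarith [Real.arctan_lt_pi_div_two t, Real.pi_pos]
  have hnorm : ‖(1 : ℂ) + t * Complex.I‖ = Real.sqrt (1 + t ^ 2) := by
    rw [key, norm_mul, Complex.norm_cos_add_sin_mul_I, Complex.norm_real,
      Real.norm_of_nonneg hs.le, mul_one]
  rw [Complex.log, harg, hnorm, Real.log_sqrt h0.le]
  congr 2
  ring

theorem one_add_mul_I_ne_zero (t : ℝ) : (1 : ℂ) + t * Complex.I ≠ 0 := fun h => by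
  simpa using congrArg Complex.re h

theorem one_sub_mul_I_ne_zero (t : ℝ) : (1 : ℂ) - t * Complex.I ≠ 0 := fun h => by
  simpa using congrArg Complex.re h

theorem one_add_mul_I_cpow (t : ℝ) (z : ℂ) :
    ((1 : ℂ) + t * Complex.I) ^ z =
      Complex.exp (z * (1 / 2 * (Real.log (1 + t ^ 2) : ℂ) + (Real.arctan t : ℂ) * Complex.I)) := by
  rw [Complex.cpow_def_of_ne_zero (one_add_mul_I_ne_zero t), log_one_add_mul_I, mul_comm,
    Complex.ofReal_mul]
  push_cast [-Complex.ofReal_arctan]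
  ring_nf

theorem one_sub_mul_I_cpow (t : ℝ) (z : ℂ) :
    ((1 : ℂ) - t * Complex.I) ^ z =
      Complex.exp (z * (1 / 2 * (Real.log (1 + t ^ 2) : ℂ) - (Real.arctan t : ℂ) * Complex.I)) := by
  have h := one_add_mul_I_cpow (-t) z
  rw [Real.arctan_neg, neg_sq] at h
  push_cast [-Complex.ofReal_arctan] at h
  rw [neg_mul, ← sub_eq_add_neg, neg_mul, ← sub_eq_add_neg] at h
  exact h

/-- The integrand `(1+it)^{-p}(1-it)^{-q}` of Cauchy's beta integral. -/
noncomputable def cauchyBetaFun (p q : ℂ) (t : ℝ) : ℂ :=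
  (1 + t * Complex.I) ^ (-p) * (1 - t * Complex.I) ^ (-q)

theorem continuous_cauchyBetaFun (p q : ℂ) : Continuous (cauchyBetaFun p q) := by
  refine Continuous.mul ?_ ?_
  · refine Continuous.cpow (by fun_prop) continuous_const fun t => Or.inl ?_
    simp
  · refine Continuous.cpow (by fun_prop) continuous_const fun t => Or.inl ?_
    simp

theorem norm_cauchyBetaFun_le (p q : ℂ) (t : ℝ) :
    ‖cauchyBetaFun p q t‖ ≤
      Real.exp (|p.im - q.im| * (Real.pi / 2)) * (1 + ‖t‖ ^ 2) ^ (-(p + q).re / 2) := by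
  have h0 : (0 : ℝ) < 1 + t ^ 2 := by positivity
  rw [cauchyBetaFun, one_add_mul_I_cpow, one_sub_mul_I_cpow, ← Complex.exp_add, Complex.norm_exp,
    Real.norm_eq_abs, sq_abs, Real.rpow_def_of_pos h0, ← Real.exp_add]
  refine Real.exp_le_exp.2 ?_
  have h1 : (p.im - q.im) * Real.arctan t ≤ |p.im - q.im| * (Real.pi / 2) := by
    refine (le_abs_self _).trans ?_
    rw [abs_mul]
    refine mul_le_mul_of_nonneg_left ?_ (abs_nonneg _)
    exact abs_le.2 ⟨(Real.neg_pi_div_two_lt_arctan t).le, (Real.arctan_lt_pi_div_two t).le⟩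
  refine le_of_eq_of_le ?_ (add_le_add_left h1 _)
  simp [-Complex.ofReal_arctan]
  ring

theorem integrable_cauchyBetaFun {p q : ℂ} (h : 1 < (p + q).re) :
    Integrable (cauchyBetaFun p q) := by
  have hb : Integrable fun t : ℝ => (1 + ‖t‖ ^ 2) ^ (-(p + q).re / 2) :=
    integrable_rpow_neg_one_add_norm_sq (by simpa using h)
  refine Integrable.mono' (hb.const_mul (Real.exp (|p.im - q.im| * (Real.pi / 2))))
    (continuous_cauchyBetaFun p q).aestronglyMeasurable ?_
  filter_upwards with t using norm_cauchyBetaFun_le p q t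

theorem tendsto_cauchyBetaFun {p q : ℂ} (h : 0 < (p + q).re) :
    Filter.Tendsto (cauchyBetaFun p q) (Filter.cocompact ℝ) (nhds 0) := by
  refine squeeze_zero_norm (norm_cauchyBetaFun_le p q) ?_
  have h1 : Filter.Tendsto (fun t : ℝ => 1 + ‖t‖ ^ 2) (Filter.cocompact ℝ) Filter.atTop :=
    Filter.tendsto_atTop_add_const_left _ _
      ((Filter.tendsto_pow_atTop two_ne_zero).comp (tendsto_norm_cocompact_atTop (E := ℝ)))
  have h2 := (tendsto_rpow_neg_atTop (half_pos h)).comp h1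
  have h3 := h2.const_mul (Real.exp (|p.im - q.im| * (Real.pi / 2)))
  rw [mul_zero] at h3
  refine h3.congr fun t => ?_
  simp only [Function.comp_apply, neg_div]

theorem hasDerivAt_cauchyBetaFun (p q : ℂ) (t : ℝ) :
    HasDerivAt (cauchyBetaFun p q)
      (-(p * Complex.I) * cauchyBetaFun (p + 1) q t + q * Complex.I * cauchyBetaFun p (q + 1) t)
      t := by
  have hid : HasDerivAt (fun t : ℝ => (t : ℂ)) 1 t := Complex.ofRealCLM.hasDerivAt
  have h1 : HasDerivAt (fun t : ℝ => (1 : ℂ) + t * Complex.I) Complex.I t := by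
    simpa using (hid.mul_const Complex.I).const_add 1
  have h2 : HasDerivAt (fun t : ℝ => (1 : ℂ) - t * Complex.I) (-Complex.I) t := by
    simpa using (hid.mul_const Complex.I).const_sub 1
  have hpow : ∀ (z c : ℂ), 0 < z.re → HasDerivAt (fun z : ℂ => z ^ c) (c * z ^ (c - 1)) z :=
    fun z c hz => by simpa using (hasDerivAt_id z).cpow_const (c := c) (Or.inl hz)
  have h := ((hpow (1 + t * Complex.I) (-p) (by simp)).comp t h1).mul
    ((hpow (1 - t * Complex.I) (-q) (by simp)).comp t h2)
  refine h.congr_deriv ?_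
  rw [cauchyBetaFun, cauchyBetaFun, neg_add', neg_add', Function.comp_apply, Function.comp_apply]
  ring

theorem integral_cauchyBetaFun_recurrence {p q : ℂ} (h : 0 < (p + q).re) :
    p * ∫ t, cauchyBetaFun (p + 1) q t = q * ∫ t, cauchyBetaFun p (q + 1) t := by
  have i1 : Integrable (cauchyBetaFun (p + 1) q) :=
    integrable_cauchyBetaFun (by simp at h ⊢; linarith)
  have i2 : Integrable (cauchyBetaFun p (q + 1)) :=
    integrable_cauchyBetaFun (by simp at h ⊢; linarith)
  have ht := tendsto_cauchyBetaFun h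
  have := integral_of_hasDerivAt_of_tendsto (hasDerivAt_cauchyBetaFun p q)
    ((i1.const_mul _).add (i2.const_mul _)) (ht.mono_left atBot_le_cocompact)
    (ht.mono_left atTop_le_cocompact)
  rw [integral_add (i1.const_mul _) (i2.const_mul _), integral_const_mul, integral_const_mul] at this
  have hI : Complex.I * (p * ∫ t, cauchyBetaFun (p + 1) q t) =
      Complex.I * (q * ∫ t, cauchyBetaFun p (q + 1) t) := by
    linear_combination -this
  exact mul_left_cancel₀ Complex.I_ne_zero hI

theorem gammaKernel_mul (p q c d : ℂ) :
    (fun s => gammaKernel p c s * gammaKernel q d s) = gammaKernel (p + q - 1) (c + d) := by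
  ext s
  by_cases hs : s ∈ Set.Ioi (0 : ℝ)
  · have h0 : (s : ℂ) ≠ 0 := by exact_mod_cast ne_of_gt hs
    simp only [gammaKernel, Set.indicator_of_mem hs]
    rw [mul_mul_mul_comm, ← Complex.cpow_add _ _ h0, ← Complex.exp_add]
    ring_nf
  · simp only [gammaKernel, Set.indicator_of_notMem hs, zero_mul]

open FourierTransform in
theorem integral_cauchyBetaFun_of_one_lt {p q : ℂ} (hp : 0 < p.re) (hq : 1 < q.re) :
    ∫ t, cauchyBetaFun p q t = 2 * Real.pi * 2 ^ (1 - p - q) * Complex.Gamma (p + q - 1) *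
      (Complex.Gamma p)⁻¹ * (Complex.Gamma q)⁻¹ := by
  have hq0 : 0 < q.re := by linarith
  have h1 : (0 : ℝ) < (1 : ℂ).re := by simp
  have hpi : (2 * Real.pi : ℂ) ≠ 0 := by simp [Real.pi_ne_zero]
  have e1 : ∀ w : ℝ, 𝓕 (gammaKernel p 1) w =
      (2 * Real.pi) ^ (-p) * Complex.Gamma p * (1 + w * Complex.I) ^ (-p) := fun w => by
    rw [fourier_gammaKernel hp h1, two_pi_mul_cpow _ _ (one_add_mul_I_ne_zero w)]
    ring
  have e2 : ∀ w : ℝ, 𝓕 (gammaKernel q 1) w =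
      (2 * Real.pi) ^ (-q) * Complex.Gamma q * (1 + w * Complex.I) ^ (-q) := fun w => by
    rw [fourier_gammaKernel hq0 h1, two_pi_mul_cpow _ _ (one_add_mul_I_ne_zero w)]
    ring
  have h_int : Integrable (𝓕 (gammaKernel q 1)) := by
    have := (integrable_cauchyBetaFun (p := q) (q := 0) (by simpa using hq)).const_mul
      ((2 * Real.pi) ^ (-q) * Complex.Gamma q)
    refine this.congr (Filter.Eventually.of_forall fun w => ?_)
    simp [e2, cauchyBetaFun]
  have h := integral_fourier_mul_fourier_neg (integrable_gammaKernel hp h1)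
    (integrable_gammaKernel hq0 h1) (continuous_gammaKernel hq) h_int
  rw [gammaKernel_mul, integral_gammaKernel (by simp; linarith) (by simp)] at h
  have e3 : ∀ w : ℝ, 𝓕 (gammaKernel p 1) w * 𝓕 (gammaKernel q 1) (-w) =
      (2 * Real.pi) ^ (-p) * Complex.Gamma p * ((2 * Real.pi) ^ (-q) * Complex.Gamma q) *
        cauchyBetaFun p q w := fun w => by
    rw [e1, e2, cauchyBetaFun]
    push_cast
    rw [neg_mul, ← sub_eq_add_neg]
    ring
  simp only [e3] at h
  rw [integral_const_mul, two_pi_mul_cpow _ _ (by norm_num)] at h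
  have g1 := Complex.Gamma_ne_zero_of_re_pos hp
  have g2 := Complex.Gamma_ne_zero_of_re_pos hq0
  have e4 : (2 * Real.pi : ℂ) ^ (-(p + q - 1)) =
      (2 * Real.pi) ^ (-p) * (2 * Real.pi) ^ (-q) * (2 * Real.pi) := by
    conv_rhs => rw [← Complex.cpow_one (2 * Real.pi : ℂ)]
    simp only [Complex.cpow_one]
    rw [← Complex.cpow_add _ _ hpi]
    conv_rhs => enter [2]; rw [← Complex.cpow_one (2 * Real.pi : ℂ)]
    rw [← Complex.cpow_add _ _ hpi]
    ring_nf
  have n1 : (2 * Real.pi : ℂ) ^ (-p) ≠ 0 := by simp [Complex.cpow_eq_zero_iff, hpi]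
  have n2 : (2 * Real.pi : ℂ) ^ (-q) ≠ 0 := by simp [Complex.cpow_eq_zero_iff, hpi]
  rw [e4, one_add_one_eq_two, show -(p + q - 1) = 1 - p - q by ring] at h
  field_simp
  refine mul_left_cancel₀ (mul_ne_zero n1 n2) ?_
  linear_combination h

theorem integral_cauchyBetaFun {p q : ℂ} (hp : 0 < p.re) (hq : 1 < q.re) (hp' : p.im ≠ 0)
    (hq' : q.im ≠ 0) (m : ℤ) :
    ∫ t, cauchyBetaFun (p - m) (q + m) t =
      2 * Real.pi * 2 ^ (1 - p - q) * Complex.Gamma (p + q - 1) *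
      (Complex.Gamma (p - m))⁻¹ * (Complex.Gamma (q + m))⁻¹ := by
  have step : ∀ k : ℤ,
      (p - (k + 1)) * (∫ t, cauchyBetaFun (p - k) (q + k) t) =
        (q + k) * ∫ t, cauchyBetaFun (p - (k + 1)) (q + (k + 1)) t := fun k => by
    have := integral_cauchyBetaFun_recurrence (p := p - (k + 1)) (q := q + k)
      (by simp; linarith)
    rwa [show p - ((k : ℂ) + 1) + 1 = p - k by ring, add_assoc] at this
  have hqk : ∀ k : ℤ, q + k ≠ 0 := fun k h => hq' (by simpa using congrArg Complex.im h)
  have hpk : ∀ k : ℤ, p - (k + 1) ≠ 0 := fun k h => hp' (by simpa using congrArg Complex.im h)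
  have g1 : ∀ k : ℤ, (Complex.Gamma (p - (k + 1)))⁻¹ =
      (p - (k + 1)) * (Complex.Gamma (p - k))⁻¹ := fun k => by
    rw [Complex.one_div_Gamma_eq_self_mul_one_div_Gamma_add_one]
    ring_nf
  have g2 : ∀ k : ℤ, (Complex.Gamma (q + k))⁻¹ =
      (q + k) * (Complex.Gamma (q + (k + 1)))⁻¹ := fun k => by
    rw [Complex.one_div_Gamma_eq_self_mul_one_div_Gamma_add_one]
    ring_nf
  induction m using Int.induction_on with
  | zero => simpa using integral_cauchyBetaFun_of_one_lt hp hq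
  | succ k ih =>
    have s := step k
    have a := g1 k
    have b := g2 k
    push_cast at s a b ih ⊢
    refine mul_left_cancel₀ (a := q + (k : ℂ)) (by exact_mod_cast hqk k) ?_
    rw [← s, ih, a, b]
    ring
  | pred k ih =>
    have s := step (-k - 1)
    have a := g1 (-k - 1)
    have b := g2 (-k - 1)
    have c := hpk (-k - 1)
    push_cast at s a b ih c ⊢
    rw [sub_add_cancel] at s a b c
    refine mul_left_cancel₀ c ?_
    rw [s, ih, a, b]
    ring

theorem exp_neg_two_pi_abs_ae_eq :
    (fun s : ℝ => Complex.exp (-(2 * Real.pi * (|s| : ℝ)))) =ᵐ[volume]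
      fun s => gammaKernel 1 1 s + gammaKernel 1 1 (-s) := by
  have h0 : ∀ᵐ s : ℝ, s ≠ 0 := by simp [ae_iff]
  filter_upwards [h0] with s hs
  rcases lt_or_gt_of_ne hs with h | h
  · rw [gammaKernel, Set.indicator_of_notMem (by simpa using h.le),
      Set.indicator_of_mem (by simpa using h), abs_of_neg h]
    simp
  · rw [gammaKernel, Set.indicator_of_mem (by simpa using h),
      Set.indicator_of_notMem (by simpa using h.le), abs_of_pos h]
    simp

open FourierTransform in
theorem fourier_exp_neg_two_pi_abs (w : ℝ) :
    𝓕 (fun s : ℝ => Complex.exp (-(2 * Real.pi * (|s| : ℝ)))) w =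
      ((Real.pi * (1 + w ^ 2) : ℝ) : ℂ)⁻¹ := by
  have h1 : (0 : ℝ) < (1 : ℂ).re := by simp
  have hi := integrable_gammaKernel h1 h1
  have hi' : Integrable fun s => gammaKernel 1 1 (-s) := hi.comp_neg
  have hae := exp_neg_two_pi_abs_ae_eq
  have e : 𝓕 (fun s : ℝ => Complex.exp (-(2 * Real.pi * (|s| : ℝ)))) w =
      𝓕 (gammaKernel 1 1) w + 𝓕 (gammaKernel 1 1) (-w) := by
    rw [Real.fourier_real_eq_integral_exp_smul, Real.fourier_real_eq_integral_exp_smul,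
      Real.fourier_real_eq_integral_exp_smul, ← integral_neg_eq_self
        (fun v : ℝ => Complex.exp (↑(-2 * Real.pi * v * -w) * Complex.I) • gammaKernel 1 1 v),
      ← integral_add]
    · refine integral_congr_ae ?_
      filter_upwards [hae] with s hs
      rw [hs, smul_add]
      ring_nf
    · refine hi.bdd_mul (c := 1) (by fun_prop) (Filter.Eventually.of_forall fun v => ?_)
      rw [Complex.norm_exp_ofReal_mul_I]
    · refine hi'.bdd_mul (c := 1) (by fun_prop) (Filter.Eventually.of_forall fun v => ?_)
      rw [Complex.norm_exp_ofReal_mul_I]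
  rw [e, fourier_gammaKernel h1 h1, fourier_gammaKernel h1 h1]
  have a1 := one_add_mul_I_ne_zero w
  have a2 := one_sub_mul_I_ne_zero w
  have a3 : (Real.pi : ℂ) ≠ 0 := by simp [Real.pi_ne_zero]
  have a4 : ((1 : ℂ) + w * Complex.I) * (1 - w * Complex.I) = 1 + w ^ 2 := by
    linear_combination -(w : ℂ) ^ 2 * Complex.I_sq
  push_cast
  rw [← a4, Complex.Gamma_one, neg_mul, ← sub_eq_add_neg, Complex.cpow_neg_one,
    Complex.cpow_neg_one]
  field_simp
  ring

open FourierTransform in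
/-- Poisson's integral for `(c + iw)^{-p}`, in the right half-plane. -/
theorem integral_add_mul_I_cpow_mul_poisson {p c : ℂ} (hp : 0 < p.re) (hc : 0 < c.re) :
    ∫ w : ℝ, (c + w * Complex.I) ^ (-p) * ((1 + w ^ 2 : ℝ) : ℂ)⁻¹ =
      Real.pi * (c + 1) ^ (-p) := by
  have h1 : (0 : ℝ) < (1 : ℂ).re := by simp
  set g : ℝ → ℂ := fun s : ℝ => Complex.exp (-(2 * Real.pi * (|s| : ℝ))) with hg
  have hgc : Continuous g := by
    have : Continuous fun s : ℝ => ((|s| : ℝ) : ℂ) := Complex.continuous_ofReal.comp continuous_abs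
    fun_prop
  have hgi : Integrable g := by
    have hi := integrable_gammaKernel h1 h1
    have hi' : Integrable fun s => gammaKernel 1 1 (-s) := hi.comp_neg
    exact (hi.add hi').congr exp_neg_two_pi_abs_ae_eq.symm
  have hFi : Integrable (𝓕 g) := by
    have := ((integrable_inv_one_add_sq.const_mul (Real.pi)⁻¹).ofReal (𝕜 := ℂ))
    refine this.congr (Filter.Eventually.of_forall fun w => ?_)
    simp only [hg]
    rw [fourier_exp_neg_two_pi_abs]
    simp [mul_comm]
  have h := integral_fourier_mul_fourier_neg (integrable_gammaKernel hp hc) hgi hgc hFi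
  have e1 : ∀ w : ℝ, c + w * Complex.I ≠ 0 := fun w h => by
    have := congrArg Complex.re h
    simp at this
    linarith
  have hc1 : 0 < (c + 1).re := by simp; linarith
  have e2 : c + 1 ≠ 0 := fun h => by
    rw [h] at hc1
    simp at hc1
  have hpi : (2 * Real.pi : ℂ) ≠ 0 := by simp [Real.pi_ne_zero]
  have e3 : ∀ w : ℝ, 𝓕 (gammaKernel p c) w * 𝓕 g (-w) =
      ((2 * Real.pi) ^ (-p) * Complex.Gamma p * (Real.pi : ℂ)⁻¹) *
        ((c + w * Complex.I) ^ (-p) * ((1 + w ^ 2 : ℝ) : ℂ)⁻¹) := fun w => by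
    rw [fourier_gammaKernel hp hc, hg, fourier_exp_neg_two_pi_abs, two_pi_mul_cpow _ _ (e1 w),
      neg_sq, Complex.ofReal_mul, mul_inv]
    ring
  have e4 : ∀ s, gammaKernel p c s * g s = gammaKernel p (c + 1) s := fun s => by
    by_cases hs : s ∈ Set.Ioi (0 : ℝ)
    · simp only [gammaKernel, Set.indicator_of_mem hs, hg, abs_of_pos (Set.mem_Ioi.1 hs)]
      rw [mul_assoc, ← Complex.exp_add]
      ring_nf
    · simp only [gammaKernel, Set.indicator_of_notMem hs, zero_mul]
  simp only [e3, e4] at h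
  rw [integral_const_mul, integral_gammaKernel hp hc1, two_pi_mul_cpow _ _ e2] at h
  have g1 := Complex.Gamma_ne_zero_of_re_pos hp
  have n1 : (2 * Real.pi : ℂ) ^ (-p) ≠ 0 := by simp [Complex.cpow_eq_zero_iff, hpi]
  have a3 : (Real.pi : ℂ) ≠ 0 := by simp [Real.pi_ne_zero]
  field_simp at h
  simp only [div_eq_mul_inv] at h
  exact h

theorem norm_cpow_neg_le {z : ℂ} {ε y : ℝ} (h0 : 0 < ε) (hz : ε ≤ z.re) :
    ‖z ^ ((-ε : ℂ) + y * Complex.I)‖ ≤ Real.exp (1 + Real.pi * |y|) := by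
  have hz0 : z ≠ 0 := fun h => by
    rw [h] at hz
    simp at hz
    linarith
  have hn : ε ≤ ‖z‖ := hz.trans (Complex.re_le_norm z)
  have hlog : -ε * Real.log ‖z‖ ≤ 1 := by
    have h1 : Real.log ε ≤ Real.log ‖z‖ := Real.log_le_log h0 hn
    have h2 : Real.log ε⁻¹ ≤ ε⁻¹ := (Real.log_le_sub_one_of_pos (inv_pos.2 h0)).trans (by linarith)
    rw [Real.log_inv] at h2
    have h3 : ε * -Real.log ε ≤ 1 := by
      calc ε * -Real.log ε ≤ ε * ε⁻¹ := mul_le_mul_of_nonneg_left h2 h0.le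
        _ = 1 := mul_inv_cancel₀ h0.ne'
    nlinarith
  have harg : -(Complex.arg z * y) ≤ Real.pi * |y| := by
    refine (neg_le_abs _).trans ?_
    rw [abs_mul]
    exact mul_le_mul_of_nonneg_right (Complex.abs_arg_le_pi z) (abs_nonneg y)
  rw [Complex.cpow_def_of_ne_zero hz0, Complex.norm_exp]
  refine Real.exp_le_exp.2 ?_
  simp [Complex.log_re, Complex.log_im]
  linarith

/-- Poisson's integral for an imaginary power, with boundary values on the imaginary axis. -/
theorem integral_imaginary_cpow_mul_poisson (y v : ℝ) :
    ∫ w : ℝ, (((v + w : ℝ) : ℂ) * Complex.I) ^ (y * Complex.I) * ((1 + w ^ 2 : ℝ) : ℂ)⁻¹ =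
      Real.pi * (1 + v * Complex.I) ^ (y * Complex.I) := by
  set l : Filter ℝ := nhdsWithin 0 (Set.Ioi 0) with hl
  have hpos : ∀ᶠ ε : ℝ in l, 0 < ε := self_mem_nhdsWithin
  have hε : Filter.Tendsto (fun ε : ℝ => (ε : ℂ)) l (nhds 0) :=
    (Complex.continuous_ofReal.tendsto' 0 0 rfl).mono_left nhdsWithin_le_nhds
  have hlim : Filter.Tendsto (fun ε : ℝ => ∫ w : ℝ,
      ((ε + v * Complex.I) + w * Complex.I) ^ ((-ε : ℂ) + y * Complex.I) *
        ((1 + w ^ 2 : ℝ) : ℂ)⁻¹) l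
      (nhds (∫ w : ℝ, (((v + w : ℝ) : ℂ) * Complex.I) ^ (y * Complex.I) *
        ((1 + w ^ 2 : ℝ) : ℂ)⁻¹)) := by
    refine tendsto_integral_filter_of_dominated_convergence
      (fun w => Real.exp (1 + Real.pi * |y|) * (1 + w ^ 2)⁻¹) ?_ ?_
      (integrable_inv_one_add_sq.const_mul _) ?_
    · filter_upwards [hpos] with ε h
      refine (Continuous.mul ?_ ?_).aestronglyMeasurable
      · refine Continuous.cpow (by fun_prop) continuous_const fun t => Or.inl ?_
        simpa using h
      · refine Continuous.inv₀ (by fun_prop) fun w => ?_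
        have : (0 : ℝ) < 1 + w ^ 2 := by positivity
        exact_mod_cast this.ne'
    · filter_upwards [hpos] with ε h
      filter_upwards with w
      have h1 : (0 : ℝ) < 1 + w ^ 2 := by positivity
      rw [norm_mul, norm_inv, Complex.norm_real, Real.norm_of_nonneg h1.le]
      refine mul_le_mul_of_nonneg_right (norm_cpow_neg_le h ?_) (inv_nonneg.2 h1.le)
      simp
    · have h0 : ∀ᵐ w : ℝ, w ≠ -v := by simp [ae_iff]
      filter_upwards [h0] with w hw
      refine Filter.Tendsto.mul_const _ ?_
      have hvw : v + w ≠ 0 := fun h => hw (by linarith)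
      have hc := continuousAt_cpow (p := (((v + w : ℝ) : ℂ) * Complex.I, (y : ℂ) * Complex.I))
        (Or.inr (by simpa using hvw))
      have t1 : Filter.Tendsto (fun ε : ℝ => ((ε + v * Complex.I) + w * Complex.I,
          (-ε : ℂ) + y * Complex.I)) l
          (nhds (((v + w : ℝ) : ℂ) * Complex.I, (y : ℂ) * Complex.I)) := by
        refine Filter.Tendsto.prodMk_nhds ?_ ?_
        · have := (hε.add_const (v * Complex.I)).add_const (w * Complex.I)
          convert this using 2
          push_cast
          ring
        · simpa using hε.neg.add_const ((y : ℂ) * Complex.I)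
      exact hc.tendsto.comp t1
  have hlim2 : Filter.Tendsto (fun ε : ℝ => Real.pi *
      ((ε + v * Complex.I) + 1) ^ ((-ε : ℂ) + y * Complex.I)) l
      (nhds (Real.pi * (1 + v * Complex.I) ^ (y * Complex.I))) := by
    refine Filter.Tendsto.const_mul _ ?_
    have hc := continuousAt_cpow (p := (1 + v * Complex.I, (y : ℂ) * Complex.I))
      (Or.inl (by simp))
    have t1 : Filter.Tendsto (fun ε : ℝ => ((ε + v * Complex.I) + 1,
        (-ε : ℂ) + y * Complex.I)) l (nhds (1 + v * Complex.I, (y : ℂ) * Complex.I)) := by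
      refine Filter.Tendsto.prodMk_nhds ?_ ?_
      · have := (hε.add_const (v * Complex.I)).add_const 1
        convert this using 2
        ring
      · simpa using hε.neg.add_const ((y : ℂ) * Complex.I)
    exact hc.tendsto.comp t1
  refine tendsto_nhds_unique hlim (hlim2.congr' ?_)
  filter_upwards [hpos] with ε h
  have := integral_add_mul_I_cpow_mul_poisson (p := ε - y * Complex.I) (c := ε + v * Complex.I)
    (by simpa using h) (by simpa using h)
  rw [neg_sub, sub_eq_neg_add] at this
  exact this.symm

/-- The odd imaginary power `sgn(x) |x|^{iy}`, up to the factor `-2 sinh(πy/2)`. -/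
noncomputable def oddCpow (y x : ℝ) : ℂ :=
  ((x : ℂ) * Complex.I) ^ (y * Complex.I) - (-(x : ℂ) * Complex.I) ^ (y * Complex.I)

theorem oddCpow_eq {x : ℝ} (hx : x ≠ 0) (y : ℝ) :
    oddCpow y x = -2 * Complex.sinh (Real.pi * y / 2) *
      ((SignType.sign x : ℝ) * Complex.exp (y * Complex.I * Real.log |x|)) := by
  have key : ∀ a : ℝ, 0 < a → Complex.log (a * Complex.I) = Real.log a + Real.pi / 2 * Complex.I ∧
      Complex.log (-a * Complex.I) = Real.log a - Real.pi / 2 * Complex.I := fun a ha => by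
    refine ⟨?_, ?_⟩
    · rw [Complex.log_ofReal_mul ha Complex.I_ne_zero, Complex.log_I]
    · rw [neg_mul_comm, Complex.log_ofReal_mul ha (neg_ne_zero.2 Complex.I_ne_zero),
        Complex.log_neg_I]
      ring
  have hexp : ∀ L : ℂ, Complex.exp ((L + Real.pi / 2 * Complex.I) * (y * Complex.I)) -
      Complex.exp ((L - Real.pi / 2 * Complex.I) * (y * Complex.I)) =
      -2 * Complex.sinh (Real.pi * y / 2) * Complex.exp (y * Complex.I * L) := fun L => by
    rw [show (L + Real.pi / 2 * Complex.I) * (y * Complex.I) =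
        y * Complex.I * L + -(Real.pi * y / 2) by
          linear_combination (Real.pi * y / 2 : ℂ) * Complex.I_sq,
      show (L - Real.pi / 2 * Complex.I) * (y * Complex.I) =
        y * Complex.I * L + (Real.pi * y / 2) by
          linear_combination -(Real.pi * y / 2 : ℂ) * Complex.I_sq,
      Complex.exp_add, Complex.exp_add, Complex.sinh]
    ring
  have hx' : (x : ℂ) ≠ 0 := by exact_mod_cast hx
  rw [oddCpow, Complex.cpow_def_of_ne_zero (mul_ne_zero hx' Complex.I_ne_zero),
    Complex.cpow_def_of_ne_zero (mul_ne_zero (neg_ne_zero.2 hx') Complex.I_ne_zero)]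
  rcases lt_or_gt_of_ne hx with h | h
  · obtain ⟨k1, k2⟩ := key (-x) (neg_pos.2 h)
    push_cast at k1 k2
    rw [neg_neg] at k2
    rw [k1, k2, sign_neg h, abs_of_neg h, ← neg_sub, hexp]
    simp
  · obtain ⟨k1, k2⟩ := key x h
    rw [k1, k2, sign_pos h, abs_of_pos h, hexp]
    simp

theorem norm_cpow_mul_I_le (z : ℂ) (y : ℝ) :
    ‖z ^ ((y : ℂ) * Complex.I)‖ ≤ Real.exp (Real.pi * |y|) := by
  refine (Complex.norm_cpow_le z _).trans ?_
  have harg : -(Complex.arg z * y) ≤ Real.pi * |y| := by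
    refine (neg_le_abs _).trans ?_
    rw [abs_mul]
    exact mul_le_mul_of_nonneg_right (Complex.abs_arg_le_pi z) (abs_nonneg y)
  simpa [← Real.exp_neg] using harg

theorem norm_oddCpow_le (y x : ℝ) : ‖oddCpow y x‖ ≤ 2 * Real.exp (Real.pi * |y|) := by
  refine (norm_sub_le _ _).trans ?_
  rw [two_mul]
  exact add_le_add (norm_cpow_mul_I_le _ y) (norm_cpow_mul_I_le _ y)

theorem measurable_oddCpow (y : ℝ) : Measurable (oddCpow y) := by
  unfold oddCpow
  fun_prop

theorem integrable_imaginary_cpow_mul_poisson (y v : ℝ) :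
    Integrable fun w : ℝ => (((v + w : ℝ) : ℂ) * Complex.I) ^ (y * Complex.I) *
      ((1 + w ^ 2 : ℝ) : ℂ)⁻¹ := by
  have h : Integrable fun w : ℝ => ((1 + w ^ 2 : ℝ) : ℂ)⁻¹ := by
    simpa using integrable_inv_one_add_sq.ofReal (𝕜 := ℂ)
  exact h.bdd_mul (c := Real.exp (Real.pi * |y|))
    (Measurable.aestronglyMeasurable (by fun_prop))
    (Filter.Eventually.of_forall fun w => norm_cpow_mul_I_le _ y)

theorem integral_oddCpow_mul_poisson (y v : ℝ) :
    ∫ w : ℝ, oddCpow y (v + w) * ((1 + w ^ 2 : ℝ) : ℂ)⁻¹ =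
      Real.pi * ((1 + v * Complex.I) ^ (y * Complex.I) - (1 - v * Complex.I) ^ (y * Complex.I)) := by
  have h1 := integral_imaginary_cpow_mul_poisson y v
  have h2 := integral_imaginary_cpow_mul_poisson y (-v)
  have i2 := (integrable_imaginary_cpow_mul_poisson y (-v)).comp_neg
  rw [← integral_neg_eq_self] at h2
  rw [mul_sub, ← h1, sub_eq_add_neg 1, ← neg_mul, ← Complex.ofReal_neg, ← h2,
    ← integral_sub (integrable_imaginary_cpow_mul_poisson y v) i2]
  congr 1
  ext w
  rw [oddCpow, neg_sq, ← neg_add, sub_mul, Complex.ofReal_neg]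

section MobiusSubstitution

variable {u K : ℝ}

theorem hasDerivAt_sub_div_add {v : ℝ} (h : u + v ≠ 0) :
    HasDerivAt (fun v => u - K / (u + v)) (K / (u + v) ^ 2) v := by
  have h1 : HasDerivAt (fun v => u + v) 1 v := (hasDerivAt_id v).const_add u
  refine (((hasDerivAt_const v K).div h1 h).const_sub u).congr_deriv ?_
  ring

theorem injOn_sub_div_add (hK : 0 < K) : Set.InjOn (fun v => u - K / (u + v)) {-u}ᶜ := by
  intro a ha b hb hab
  have ha' : u + a ≠ 0 := fun h => ha (by simp; linarith)
  have hb' : u + b ≠ 0 := fun h => hb (by simp; linarith)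
  have h : K / (u + a) = K / (u + b) := by simpa using hab
  rw [div_eq_div_iff ha' hb'] at h
  have := mul_left_cancel₀ hK.ne' h
  linarith

theorem image_sub_div_add (hK : 0 < K) : Set.image (fun v => u - K / (u + v)) {-u}ᶜ = {u}ᶜ := by
  ext t
  constructor
  · rintro ⟨v, hv, rfl⟩ h
    have hv' : u + v ≠ 0 := fun h => hv (by simp; linarith)
    have : K / (u + v) ≠ 0 := div_ne_zero hK.ne' hv'
    simp at h
    exact h.elim hK.ne' hv'
  · intro ht
    have ht' : u - t ≠ 0 := fun h => ht (by simp; linarith)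
    refine ⟨K / (u - t) - u, fun h => ?_, ?_⟩
    · have : K / (u - t) = 0 := by simpa using h
      exact div_ne_zero hK.ne' ht' this
    · simp only [add_sub_cancel]
      rw [div_div_cancel₀ hK.ne']
      ring

theorem integrable_comp_sub_div_add_iff (hK : 0 < K) (φ : ℝ → ℂ) :
    Integrable (fun v => (K / (u + v) ^ 2) • φ (u - K / (u + v))) ↔ Integrable φ := by
  have h := integrableOn_image_iff_integrableOn_abs_deriv_smul (s := {-u}ᶜ)
    (measurableSet_singleton (-u)).compl
    (fun v hv => (hasDerivAt_sub_div_add (K := K) fun h => hv (by simp; linarith)).hasDerivWithinAt)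
    (injOn_sub_div_add hK) φ
  simp only [abs_of_nonneg (div_nonneg hK.le (sq_nonneg _))] at h
  rw [image_sub_div_add hK, IntegrableOn, IntegrableOn, restrict_compl_singleton,
    restrict_compl_singleton] at h
  exact h.symm

theorem integral_comp_sub_div_add {E : Type*} [NormedAddCommGroup E] [NormedSpace ℝ E]
    (hK : 0 < K) (φ : ℝ → E) :
    ∫ v, (K / (u + v) ^ 2) • φ (u - K / (u + v)) = ∫ t, φ t := by
  have h := integral_image_eq_integral_abs_deriv_smul (s := {-u}ᶜ)
    (measurableSet_singleton (-u)).compl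
    (fun v hv => (hasDerivAt_sub_div_add (K := K) fun h => hv (by simp; linarith)).hasDerivWithinAt)
    (injOn_sub_div_add hK) φ
  simp only [abs_of_nonneg (div_nonneg hK.le (sq_nonneg _))] at h
  rw [image_sub_div_add hK, restrict_compl_singleton,
    restrict_compl_singleton] at h
  exact h.symm

end MobiusSubstitution

theorem fz_eq_cauchyBetaFun (ζ : ℂ) (μ : ℤ) (t : ℝ) :
    fz ζ μ t = (Real.pi : ℂ) ^ (-(1/2) : ℂ) *
      cauchyBetaFun (1 / 2 - ζ - (μ : ℂ) / 2) (1 / 2 - ζ + (μ : ℂ) / 2) t := by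
  rw [fz, cauchyBetaFun, mul_assoc]
  ring_nf

theorem fz_eq_exp (ζ : ℂ) (μ : ℤ) (t : ℝ) :
    fz ζ μ t = (Real.pi : ℂ) ^ (-(1/2) : ℂ) *
      Complex.exp ((ζ - 1 / 2) * (Real.log (1 + t ^ 2) : ℂ)) *
      Complex.exp ((Real.arctan t : ℂ) * Complex.I) ^ μ := by
  rw [fz, one_add_mul_I_cpow, one_sub_mul_I_cpow, mul_assoc, mul_assoc, ← Complex.exp_add,
    ← Complex.exp_int_mul, ← Complex.exp_add]
  ring_nf

theorem exp_arctan_mul_I (t : ℝ) :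
    Complex.exp ((Real.arctan t : ℂ) * Complex.I) =
      (1 + t * Complex.I) / (Real.sqrt (1 + t ^ 2) : ℂ) := by
  rw [Complex.exp_mul_I, ← Complex.ofReal_cos, ← Complex.ofReal_sin, Real.cos_arctan,
    Real.sin_arctan]
  push_cast
  ring

theorem one_add_sq_sub_div_add {u v : ℝ} (h : u + v ≠ 0) :
    1 + (u - (1 + u ^ 2) / (u + v)) ^ 2 = (1 + u ^ 2) * (1 + v ^ 2) / |u + v| ^ 2 := by
  rw [sq_abs]
  field_simp
  ring

theorem exp_arctan_sub_div_add {u v : ℝ} (h : u + v ≠ 0) :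
    Complex.exp ((Real.arctan (u - (1 + u ^ 2) / (u + v)) : ℂ) * Complex.I) =
      -Complex.I * (SignType.sign (u + v) : ℝ) * Complex.exp ((Real.arctan v : ℂ) * Complex.I) *
        Complex.exp ((Real.arctan u : ℂ) * Complex.I) := by
  have hu : (0 : ℝ) < 1 + u ^ 2 := by positivity
  have hv : (0 : ℝ) < 1 + v ^ 2 := by positivity
  have hs : ((SignType.sign (u + v) : ℝ) : ℂ) = (|u + v| : ℝ) / (u + v : ℝ) := by
    rw [← Complex.ofReal_div]
    congr 1
    rw [eq_div_iff h, sign_mul_self]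
  rw [exp_arctan_mul_I, exp_arctan_mul_I, exp_arctan_mul_I, one_add_sq_sub_div_add h,
    Real.sqrt_div (by positivity), Real.sqrt_mul hu.le, Real.sqrt_sq (abs_nonneg _), hs]
  have h1 : (Real.sqrt (1 + u ^ 2) : ℂ) ≠ 0 := by exact_mod_cast (Real.sqrt_pos.2 hu).ne'
  have h2 : (Real.sqrt (1 + v ^ 2) : ℂ) ≠ 0 := by exact_mod_cast (Real.sqrt_pos.2 hv).ne'
  have h3 : ((u : ℂ) + v) ≠ 0 := by exact_mod_cast h
  have h4 : ((|u + v| : ℝ) : ℂ) ≠ 0 := by exact_mod_cast (abs_pos.2 h).ne'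
  push_cast
  field_simp
  linear_combination ((u : ℂ) + v + Complex.I * u * v) * Complex.I_sq

theorem log_one_add_sq_sub_div_add {u v : ℝ} (h : u + v ≠ 0) :
    Real.log (1 + (u - (1 + u ^ 2) / (u + v)) ^ 2) =
      Real.log (1 + u ^ 2) + Real.log (1 + v ^ 2) - 2 * Real.log |u + v| := by
  have hu : (0 : ℝ) < 1 + u ^ 2 := by positivity
  have hv : (0 : ℝ) < 1 + v ^ 2 := by positivity
  have h1 : |u + v| ≠ 0 := (abs_pos.2 h).ne'
  rw [one_add_sq_sub_div_add h, Real.log_div (by positivity) (by positivity),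
    Real.log_mul hu.ne' hv.ne', Real.log_pow]
  norm_num

theorem integrand_comp_sub_div_add {ξ η : ℝ} (hη : η ≠ 0) {ζ : ℂ}
    (hζ : ζ = (ξ : ℂ) + (η : ℂ) * Complex.I) {μ : ℤ} (hμ : Odd μ) {u v : ℝ} (h : u + v ≠ 0) :
    ((1 + u ^ 2) / (u + v) ^ 2 : ℝ) • (fz ζ μ (u - (1 + u ^ 2) / (u + v)) *
      fz ((starRingEnd ℂ) ζ) (-μ) u *
        ((|u - (1 + u ^ 2) / (u + v) - u| ^ (-2 * ξ - 1) : ℝ) : ℂ)) =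
      (-Complex.I) ^ μ * (Real.pi : ℂ) ^ (-(1/2) : ℂ) * (2 * Complex.sinh (Real.pi * η))⁻¹ *
        (fz ζ μ v * (oddCpow (-2 * η) (v + u) * ((1 + u ^ 2 : ℝ) : ℂ)⁻¹)) := by
  have hu : (0 : ℝ) < 1 + u ^ 2 := by positivity
  have h1 : 0 < |u + v| := abs_pos.2 h
  have hsinh : Complex.sinh (Real.pi * η) ≠ 0 := by
    rw [← Complex.ofReal_mul, ← Complex.ofReal_sinh, Complex.ofReal_ne_zero, Real.sinh_ne_zero]
    exact mul_ne_zero Real.pi_ne_zero hη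
  have habs : |u - (1 + u ^ 2) / (u + v) - u| = (1 + u ^ 2) / |u + v| := by
    rw [sub_sub_cancel_left, abs_neg, abs_div, abs_of_pos hu]
  have hpow : ((|u - (1 + u ^ 2) / (u + v) - u| ^ (-2 * ξ - 1) : ℝ) : ℂ) =
      Complex.exp ((-2 * ξ - 1) * (Real.log (1 + u ^ 2) - Real.log |u + v|)) := by
    rw [habs, Real.rpow_def_of_pos (by positivity), Real.log_div hu.ne' h1.ne']
    push_cast
    ring_nf
  have hjac : (((1 + u ^ 2) / (u + v) ^ 2 : ℝ) : ℂ) =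
      Complex.exp (Real.log (1 + u ^ 2) - 2 * Real.log |u + v|) := by
    have : (1 + u ^ 2) / (u + v) ^ 2 = Real.exp (Real.log (1 + u ^ 2) - 2 * Real.log |u + v|) := by
      rw [Real.exp_sub, Real.exp_log hu, mul_comm, Real.exp_mul, Real.exp_log h1]
      norm_num
    rw [this]
    push_cast
    rfl
  have hinv : ((1 + u ^ 2 : ℝ) : ℂ)⁻¹ = Complex.exp (-(Real.log (1 + u ^ 2) : ℂ)) := by
    rw [← Complex.ofReal_neg, ← Complex.ofReal_exp, Real.exp_neg, Real.exp_log hu,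
      Complex.ofReal_inv]
  have hsign : ((SignType.sign (u + v) : ℝ) : ℂ) ^ μ = (SignType.sign (u + v) : ℝ) := by
    rcases lt_or_gt_of_ne h with h | h
    · simp [sign_neg h, hμ.neg_one_zpow]
    · simp [sign_pos h]
  have hodd : oddCpow (-2 * η) (v + u) = 2 * Complex.sinh (Real.pi * η) *
      ((SignType.sign (u + v) : ℝ) *
        Complex.exp (-2 * η * Complex.I * (Real.log |u + v| : ℂ))) := by
    rw [add_comm v u, oddCpow_eq h,
      show (Real.pi : ℂ) * ((-2 * η : ℝ) : ℂ) / 2 = -(Real.pi * η) by push_cast; ring,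
      Complex.sinh_neg]
    push_cast
    ring
  have hEu := Complex.exp_ne_zero ((Real.arctan u : ℂ) * Complex.I)
  rw [hodd, fz_eq_exp, fz_eq_exp, fz_eq_exp, hpow, Complex.real_smul, hjac, hinv,
    exp_arctan_sub_div_add h, log_one_add_sq_sub_div_add h, mul_zpow, mul_zpow, mul_zpow, hsign,
    zpow_neg]
  have hcomb : Complex.exp (Real.log (1 + u ^ 2) - 2 * Real.log |u + v|) *
      Complex.exp ((ζ - 1 / 2) * ((Real.log (1 + u ^ 2) + Real.log (1 + v ^ 2) -
        2 * Real.log |u + v| : ℝ) : ℂ)) *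
      Complex.exp (((starRingEnd ℂ) ζ - 1 / 2) * (Real.log (1 + u ^ 2) : ℂ)) *
      Complex.exp ((-2 * ξ - 1) * (Real.log (1 + u ^ 2) - Real.log |u + v|)) =
      Complex.exp ((ζ - 1 / 2) * (Real.log (1 + v ^ 2) : ℂ)) *
      Complex.exp (-2 * η * Complex.I * (Real.log |u + v| : ℂ)) *
      Complex.exp (-(Real.log (1 + u ^ 2) : ℂ)) := by
    simp only [← Complex.exp_add]
    congr 1
    rw [hζ]
    simp only [map_add, map_mul, Complex.conj_ofReal, Complex.conj_I]
    push_cast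
    ring
  have hz := zpow_ne_zero μ hEu
  generalize Complex.exp ((Real.arctan u : ℂ) * Complex.I) ^ μ = Eu at *
  generalize Complex.exp ((Real.arctan v : ℂ) * Complex.I) ^ μ = Ev at *
  generalize Complex.sinh (Real.pi * η) = S at *
  have hE : Eu * Eu⁻¹ = 1 := mul_inv_cancel₀ hz
  have hS : (2 * S)⁻¹ * (2 * S) = 1 := inv_mul_cancel₀ (mul_ne_zero two_ne_zero hsinh)
  generalize Eu⁻¹ = Ei at *
  generalize (2 * S)⁻¹ = Si at *
  generalize (Real.pi : ℂ) ^ (-(1/2) : ℂ) = P at *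
  generalize (-Complex.I) ^ μ = M at *
  generalize ((SignType.sign (u + v) : ℝ) : ℂ) = s at *
  generalize Complex.exp (Real.log (1 + u ^ 2) - 2 * Real.log |u + v|) = J at *
  generalize Complex.exp ((ζ - 1 / 2) * ((Real.log (1 + u ^ 2) + Real.log (1 + v ^ 2) -
        2 * Real.log |u + v| : ℝ) : ℂ)) = A at *
  generalize Complex.exp (((starRingEnd ℂ) ζ - 1 / 2) * (Real.log (1 + u ^ 2) : ℂ)) = B at *
  generalize Complex.exp ((-2 * ξ - 1) * (Real.log (1 + u ^ 2) - Real.log |u + v|)) = C at *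
  generalize Complex.exp ((ζ - 1 / 2) * (Real.log (1 + v ^ 2) : ℂ)) = D at *
  generalize Complex.exp (-2 * η * Complex.I * (Real.log |u + v| : ℂ)) = F at *
  generalize Complex.exp (-(Real.log (1 + u ^ 2) : ℂ)) = H at *
  linear_combination P ^ 2 * M * s * Ev * (J * A * B * C * hE + hcomb - D * F * H * hS)

theorem continuous_fz (ζ : ℂ) (μ : ℤ) : Continuous (fz ζ μ) := by
  rw [funext (fz_eq_cauchyBetaFun ζ μ)]
  exact continuous_const.mul (continuous_cauchyBetaFun _ _)

theorem integrable_fz {ζ : ℂ} (hζ : ζ.re < 0) (μ : ℤ) : Integrable (fz ζ μ) := by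
  rw [funext (fz_eq_cauchyBetaFun ζ μ)]
  refine (integrable_cauchyBetaFun ?_).const_mul _
  rw [show 1 / 2 - ζ - (μ : ℂ) / 2 + (1 / 2 - ζ + (μ : ℂ) / 2) = 1 - 2 * ζ by ring]
  simp
  linarith

theorem integrable_fz_mul_oddCpow {ζ : ℂ} (hζ : ζ.re < 0) (μ : ℤ) (y : ℝ) :
    Integrable (fun p : ℝ × ℝ =>
      fz ζ μ p.1 * (oddCpow y (p.1 + p.2) * ((1 + p.2 ^ 2 : ℝ) : ℂ)⁻¹)) := by
  have h1 : Integrable (fun u : ℝ => ((1 + u ^ 2 : ℝ) : ℂ)⁻¹) := by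
    simpa using (integrable_inv_one_add_sq.ofReal (𝕜 := ℂ))
  have h2 : Integrable (fun p : ℝ × ℝ => oddCpow y (p.1 + p.2) *
      (fz ζ μ p.1 * ((1 + p.2 ^ 2 : ℝ) : ℂ)⁻¹)) :=
    ((integrable_fz hζ μ).mul_prod h1).bdd_mul (c := 2 * Real.exp (Real.pi * |y|))
      ((measurable_oddCpow y).comp (measurable_fst.add measurable_snd)).aestronglyMeasurable
      (Filter.Eventually.of_forall fun p => norm_oddCpow_le _ _)
  refine h2.congr (Filter.Eventually.of_forall fun p => ?_)
  ring

section DoubleIntegral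

variable {ξ η : ℝ} {ζ : ℂ} {μ : ℤ}

theorem integrand_comp_sub_div_add_ae (hη : η ≠ 0) (hζ : ζ = (ξ : ℂ) + (η : ℂ) * Complex.I)
    (hμ : Odd μ) (u : ℝ) :
    (fun v => ((1 + u ^ 2) / (u + v) ^ 2 : ℝ) • (fz ζ μ (u - (1 + u ^ 2) / (u + v)) *
      fz ((starRingEnd ℂ) ζ) (-μ) u *
        ((|u - (1 + u ^ 2) / (u + v) - u| ^ (-2 * ξ - 1) : ℝ) : ℂ))) =ᵐ[volume] fun v =>
      (-Complex.I) ^ μ * (Real.pi : ℂ) ^ (-(1/2) : ℂ) * (2 * Complex.sinh (Real.pi * η))⁻¹ *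
        (fz ζ μ v * (oddCpow (-2 * η) (v + u) * ((1 + u ^ 2 : ℝ) : ℂ)⁻¹)) := by
  have h0 : ∀ᵐ v : ℝ, v ≠ -u := by simp [ae_iff]
  filter_upwards [h0] with v hv
  exact integrand_comp_sub_div_add hη hζ hμ fun h => hv (by linarith)

theorem integrable_fz_mul_fz_mul_abs_sub_rpow (hξ : ξ < 0) (hη : η ≠ 0)
    (hζ : ζ = (ξ : ℂ) + (η : ℂ) * Complex.I) (hμ : Odd μ) :
    Integrable (fun p : ℝ × ℝ => fz ζ μ p.1 * fz ((starRingEnd ℂ) ζ) (-μ) p.2 *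
      ((|p.1 - p.2| ^ (-2 * ξ - 1) : ℝ) : ℂ)) := by
  have hre : ζ.re < 0 := by simpa [hζ] using hξ
  have hG := (integrable_fz_mul_oddCpow hre μ (-2 * η)).const_mul
    ((-Complex.I) ^ μ * (Real.pi : ℂ) ^ (-(1/2) : ℂ) * (2 * Complex.sinh (Real.pi * η))⁻¹)
  rw [Measure.volume_eq_prod] at hG ⊢
  refine (integrable_prod_iff' ?_).2 ⟨?_, ?_⟩
  · refine Measurable.aestronglyMeasurable ?_
    have h1 := (continuous_fz ζ μ).measurable
    have h2 := (continuous_fz ((starRingEnd ℂ) ζ) (-μ)).measurable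
    fun_prop
  · filter_upwards [hG.prod_left_ae] with u hu
    rw [← integrable_comp_sub_div_add_iff (u := u) (show (0 : ℝ) < 1 + u ^ 2 by positivity)]
    exact hu.congr (integrand_comp_sub_div_add_ae hη hζ hμ u).symm
  · refine hG.integral_norm_prod_right.congr (Filter.Eventually.of_forall fun u => ?_)
    have hK : (0 : ℝ) < 1 + u ^ 2 := by positivity
    refine (integral_congr_ae ?_).trans (integral_comp_sub_div_add (u := u) hK _)
    filter_upwards [integrand_comp_sub_div_add_ae hη hζ hμ u] with v hv
    rw [← hv, norm_smul, Real.norm_of_nonneg (by positivity), smul_eq_mul]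

theorem integral_fz_mul_fz_mul_abs_sub_rpow (hξ : ξ < 0) (hη : η ≠ 0)
    (hζ : ζ = (ξ : ℂ) + (η : ℂ) * Complex.I) (hμ : Odd μ) :
    ∫ p : ℝ × ℝ, fz ζ μ p.1 * fz ((starRingEnd ℂ) ζ) (-μ) p.2 *
      ((|p.1 - p.2| ^ (-2 * ξ - 1) : ℝ) : ℂ) =
    (-Complex.I) ^ μ * (Real.pi : ℂ) ^ (-(1/2) : ℂ) * (2 * Complex.sinh (Real.pi * η))⁻¹ *
      (Real.pi * ∫ v : ℝ, fz ζ μ v * ((1 + v * Complex.I) ^ (((-2 * η : ℝ) : ℂ) * Complex.I) -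
        (1 - v * Complex.I) ^ (((-2 * η : ℝ) : ℂ) * Complex.I))) := by
  have hre : ζ.re < 0 := by simpa [hζ] using hξ
  have hG := integrable_fz_mul_oddCpow hre μ (-2 * η)
  have hF := integrable_fz_mul_fz_mul_abs_sub_rpow hξ hη hζ hμ
  rw [Measure.volume_eq_prod] at hG hF ⊢
  rw [integral_prod_symm _ hF]
  have h1 : ∀ u : ℝ, ∫ t : ℝ, fz ζ μ t * fz ((starRingEnd ℂ) ζ) (-μ) u *
      ((|t - u| ^ (-2 * ξ - 1) : ℝ) : ℂ) =
      (-Complex.I) ^ μ * (Real.pi : ℂ) ^ (-(1/2) : ℂ) * (2 * Complex.sinh (Real.pi * η))⁻¹ *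
        ∫ v, fz ζ μ v * (oddCpow (-2 * η) (v + u) * ((1 + u ^ 2 : ℝ) : ℂ)⁻¹) := by
    intro u
    rw [← integral_comp_sub_div_add (u := u) (show (0 : ℝ) < 1 + u ^ 2 by positivity),
      integral_congr_ae (integrand_comp_sub_div_add_ae hη hζ hμ u), integral_const_mul]
  simp only [h1]
  rw [integral_const_mul, ← integral_integral_swap hG, ← integral_const_mul (Real.pi : ℂ)]
  refine congrArg _ (integral_congr_ae (Filter.Eventually.of_forall fun v => ?_))
  simp only
  rw [integral_const_mul, integral_oddCpow_mul_poisson]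
  ring

end DoubleIntegral

theorem integral_fz_mul_cpow_sub_cpow {ξ η : ℝ} (hξ : ξ < 0) (hη : η ≠ 0) {ζ : ℂ}
    (hζ : ζ = (ξ : ℂ) + (η : ℂ) * Complex.I) (m : ℤ) :
    ∫ v : ℝ, fz ζ (2 * m + 1) v * ((1 + v * Complex.I) ^ (((-2 * η : ℝ) : ℂ) * Complex.I) -
        (1 - v * Complex.I) ^ (((-2 * η : ℝ) : ℂ) * Complex.I)) =
      (Real.pi : ℂ) ^ (-(1/2) : ℂ) *
        (2 * Real.pi * 2 ^ (2 * (ξ : ℂ)) * Complex.Gamma (-2 * (ξ : ℂ)) *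
          ((Complex.Gamma (-(starRingEnd ℂ) ζ - m))⁻¹ * (Complex.Gamma (1 - ζ + m))⁻¹ -
          (Complex.Gamma (-ζ - m))⁻¹ * (Complex.Gamma (1 - (starRingEnd ℂ) ζ + m))⁻¹)) := by
  have hc : (starRingEnd ℂ) ζ = (ξ : ℂ) - (η : ℂ) * Complex.I := by
    rw [hζ]
    simp [sub_eq_add_neg]
  have key : ∀ v : ℝ, fz ζ (2 * m + 1) v *
      ((1 + v * Complex.I) ^ (((-2 * η : ℝ) : ℂ) * Complex.I) -
        (1 - v * Complex.I) ^ (((-2 * η : ℝ) : ℂ) * Complex.I)) = (Real.pi : ℂ) ^ (-(1/2) : ℂ) *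
      (cauchyBetaFun (-(starRingEnd ℂ) ζ - m) (1 - ζ + m) v -
        cauchyBetaFun (-ζ - m) (1 - (starRingEnd ℂ) ζ + m) v) := by
    intro v
    rw [fz_eq_cauchyBetaFun]
    simp only [cauchyBetaFun]
    rw [show -(-(starRingEnd ℂ) ζ - m) = -(-ζ - m) + ((-2 * η : ℝ) : ℂ) * Complex.I by
        rw [hc, hζ]; push_cast; ring,
      show -(1 - (starRingEnd ℂ) ζ + m) = -(1 - ζ + m) + ((-2 * η : ℝ) : ℂ) * Complex.I by
        rw [hc, hζ]; push_cast; ring,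
      show 1 / 2 - ζ - ((2 * m + 1 : ℤ) : ℂ) / 2 = -ζ - m by push_cast; ring,
      show 1 / 2 - ζ + ((2 * m + 1 : ℤ) : ℂ) / 2 = 1 - ζ + m by push_cast; ring,
      Complex.cpow_add _ _ (one_add_mul_I_ne_zero v),
      Complex.cpow_add _ _ (one_sub_mul_I_ne_zero v)]
    ring
  have i1 : Integrable (cauchyBetaFun (-(starRingEnd ℂ) ζ - m) (1 - ζ + m)) := by
    refine integrable_cauchyBetaFun ?_
    simp [hζ]
    linarith
  have i2 : Integrable (cauchyBetaFun (-ζ - m) (1 - (starRingEnd ℂ) ζ + m)) := by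
    refine integrable_cauchyBetaFun ?_
    simp [hζ]
    linarith
  simp only [key]
  rw [integral_const_mul, integral_sub i1 i2,
    integral_cauchyBetaFun (by simpa [hζ] using hξ) (by simp [hζ]; linarith)
      (by simpa [hζ] using hη) (by simpa [hζ] using hη),
    integral_cauchyBetaFun (by simpa [hζ] using hξ) (by simp [hζ]; linarith)
      (by simpa [hζ] using hη) (by simpa [hζ] using hη),
    show 1 - -(starRingEnd ℂ) ζ - (1 - ζ) = 2 * (ξ : ℂ) by rw [hc, hζ]; ring,
    show 1 - -ζ - (1 - (starRingEnd ℂ) ζ) = 2 * (ξ : ℂ) by rw [hc, hζ]; ring,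
    show -(starRingEnd ℂ) ζ + (1 - ζ) - 1 = -2 * (ξ : ℂ) by rw [hc, hζ]; ring,
    show -ζ + (1 - (starRingEnd ℂ) ζ) - 1 = -2 * (ξ : ℂ) by rw [hc, hζ]; ring]
  ring

theorem inv_Gamma_neg_sub_intCast {s : ℂ} (hs : s.im ≠ 0) (m : ℤ) :
    (Complex.Gamma (-s - m))⁻¹ =
      -((-1) ^ m * Complex.sin (Real.pi * s) * Complex.Gamma (1 + s + m) / Real.pi) := by
  have hsin : Complex.sin (Real.pi * (-s - m)) = -((-1) ^ m * Complex.sin (Real.pi * s)) := by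
    rw [show (Real.pi : ℂ) * (-s - m) = -(Real.pi * s + m * Real.pi) by ring, Complex.sin_neg,
      Complex.sin_antiperiodic.add_int_mul_eq, Int.cast_negOnePow]
  have hne : ∀ n : ℕ, -s - m ≠ -n := fun n h => hs (by simpa using congrArg Complex.im h)
  have hG := Complex.Gamma_ne_zero hne
  have hp : (Real.pi : ℂ) ≠ 0 := by exact_mod_cast Real.pi_ne_zero
  have hsin0 : Complex.sin (Real.pi * (-s - m)) ≠ 0 := by
    rw [Complex.sin_ne_zero_iff]
    intro k h
    exact hs (by simpa using congrArg Complex.im (mul_right_cancel₀ hp ((mul_comm _ _).trans h)))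
  have h := Complex.Gamma_mul_Gamma_one_sub (-s - m)
  rw [show 1 - (-s - (m : ℂ)) = 1 + s + m by ring, eq_div_iff hsin0, hsin] at h
  generalize Complex.sin (Real.pi * s) = S at *
  field_simp
  linear_combination -h

theorem Gamma_bracket_eq_re {ξ η : ℝ} (hη : η ≠ 0) {ζ : ℂ}
    (hζ : ζ = (ξ : ℂ) + (η : ℂ) * Complex.I) (hcos : Real.cos (Real.pi * ξ) ≠ 0) (m : ℤ) :
    (-Complex.I) ^ (2 * m + 1) *
      ((Complex.Gamma (-(starRingEnd ℂ) ζ - m))⁻¹ * (Complex.Gamma (1 - ζ + m))⁻¹ -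
        (Complex.Gamma (-ζ - m))⁻¹ * (Complex.Gamma (1 - (starRingEnd ℂ) ζ + m))⁻¹) =
      2 * Real.cos (Real.pi * ξ) * Real.sinh (Real.pi * η) / Real.pi *
        ((Complex.Gamma (1 + (starRingEnd ℂ) ζ + m) / Complex.Gamma (1 - ζ + m) *
          (1 + Complex.I * (Real.tan (Real.pi * ξ) : ℂ) *
            ((Real.cosh (Real.pi * η) / Real.sinh (Real.pi * η) : ℝ) : ℂ))).re : ℝ) := by
  have him : ζ.im = η := by simp [hζ]
  have hsinh : Real.sinh (Real.pi * η) ≠ 0 := by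
    rw [Real.sinh_ne_zero]
    exact mul_ne_zero Real.pi_ne_zero hη
  have hI : (-Complex.I) ^ (2 * m + 1) = (-1) ^ m * -Complex.I := by
    rw [zpow_add₀ (neg_ne_zero.2 Complex.I_ne_zero), zpow_mul]
    simp
  have hm : ((-1 : ℂ) ^ m) * (-1) ^ m = 1 := by
    rw [← mul_zpow]
    simp
  set A := Complex.Gamma (1 + (starRingEnd ℂ) ζ + m) / Complex.Gamma (1 - ζ + m) with hA
  have hAc : (starRingEnd ℂ) A =
      Complex.Gamma (1 + ζ + m) / Complex.Gamma (1 - (starRingEnd ℂ) ζ + m) := by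
    rw [hA, map_div₀, ← Complex.Gamma_conj, ← Complex.Gamma_conj]
    simp
  have hX : A * (1 + Complex.I * (Real.tan (Real.pi * ξ) : ℂ) *
      ((Real.cosh (Real.pi * η) / Real.sinh (Real.pi * η) : ℝ) : ℂ)) *
      ((Real.cos (Real.pi * ξ) * Real.sinh (Real.pi * η) : ℝ) : ℂ) =
      Complex.I * Complex.sin (Real.pi * (starRingEnd ℂ) ζ) * A := by
    have h1 : (Real.pi : ℂ) * (starRingEnd ℂ) ζ =
        ((Real.pi * ξ : ℝ) : ℂ) - ((Real.pi * η : ℝ) : ℂ) * Complex.I := by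
      rw [hζ]
      simp
      ring
    rw [h1, Complex.sin_sub, Complex.sin_mul_I, Complex.cos_mul_I, ← Complex.ofReal_sin,
      ← Complex.ofReal_cos, ← Complex.ofReal_sinh, ← Complex.ofReal_cosh, Real.tan_eq_sin_div_cos]
    have hcos' : (Real.cos (Real.pi * ξ) : ℂ) ≠ 0 := by exact_mod_cast hcos
    have hsinh' : (Real.sinh (Real.pi * η) : ℂ) ≠ 0 := by exact_mod_cast hsinh
    simp only [Complex.ofReal_mul, Complex.ofReal_div]
    generalize ((Real.cos (Real.pi * ξ) : ℝ) : ℂ) = c at *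
    generalize ((Real.sinh (Real.pi * η) : ℝ) : ℂ) = s at *
    field_simp
    linear_combination (A * c * s) * Complex.I_sq
  set Y := A * (1 + Complex.I * (Real.tan (Real.pi * ξ) : ℂ) *
      ((Real.cosh (Real.pi * η) / Real.sinh (Real.pi * η) : ℝ) : ℂ)) with hY
  have hXc := congrArg (starRingEnd ℂ) hX
  simp only [map_mul, Complex.conj_ofReal, Complex.conj_I, ← Complex.sin_conj,
    Complex.conj_conj] at hXc
  have hre : ((Y.re : ℝ) : ℂ) = (Y + (starRingEnd ℂ) Y) / 2 := by
    rw [Complex.add_conj]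
    push_cast
    ring
  rw [hI, inv_Gamma_neg_sub_intCast (by simpa [him] using hη),
    inv_Gamma_neg_sub_intCast (by simpa [him] using hη), hre]
  push_cast at hX hXc ⊢
  trans (-1) ^ m * (-1) ^ m * (Complex.I * Complex.sin (Real.pi * (starRingEnd ℂ) ζ) * A +
    -Complex.I * Complex.sin (Real.pi * ζ) * (starRingEnd ℂ) A) / Real.pi
  · rw [hAc, hA]
    ring
  · rw [hm, ← hX, ← hXc]
    ring

theorem Gamma_neg_two_mul_mul_cos (ξ : ℝ) (h1 : -(1/2) < ξ) (h2 : ξ < 0) :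
    1 / ((Real.pi : ℂ) ^ ((1:ℂ)/2) * (2 : ℂ) ^ (-2 * (ξ : ℂ)) * Complex.Gamma (-(ξ : ℂ)) /
      Complex.Gamma (1/2 + (ξ : ℂ))) * (2 * Complex.Gamma (-2 * (ξ : ℂ)) *
        (Real.cos (Real.pi * ξ) : ℂ)) = 1 := by
  have hcos : Real.cos (Real.pi * ξ) ≠ 0 := by
    refine (Real.cos_pos_of_mem_Ioo ⟨?_, ?_⟩).ne' <;> nlinarith [Real.pi_pos]
  have hp : (Real.pi : ℂ) ≠ 0 := by exact_mod_cast Real.pi_ne_zero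
  have hd := Complex.Gamma_mul_Gamma_add_half (-(ξ : ℂ))
  have hr := Complex.Gamma_mul_Gamma_one_sub (1 / 2 + (ξ : ℂ))
  have hG1 : Complex.Gamma (-(ξ : ℂ)) ≠ 0 :=
    Complex.Gamma_ne_zero_of_re_pos (by simpa using h2)
  have hG2 : Complex.Gamma (1 / 2 + (ξ : ℂ)) ≠ 0 :=
    Complex.Gamma_ne_zero_of_re_pos (by simp; linarith)
  have hsin : Complex.sin (Real.pi * (1 / 2 + (ξ : ℂ))) = (Real.cos (Real.pi * ξ) : ℂ) := by
    rw [show (Real.pi : ℂ) * (1 / 2 + (ξ : ℂ)) = Real.pi * ξ + Real.pi / 2 by ring,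
      Complex.sin_add_pi_div_two]
    push_cast
    rfl
  have hcos' : (Real.cos (Real.pi * ξ) : ℂ) ≠ 0 := by exact_mod_cast hcos
  rw [show 1 - (1 / 2 + (ξ : ℂ)) = 1 / 2 - ξ by ring, hsin, eq_div_iff hcos'] at hr
  have hsqrt : ((Real.sqrt Real.pi : ℝ) : ℂ) = (Real.pi : ℂ) ^ ((1 : ℂ) / 2) := by
    rw [Real.sqrt_eq_rpow, Complex.ofReal_cpow Real.pi_pos.le]
    norm_num
  have hs2 : (Real.pi : ℂ) ^ ((1 : ℂ) / 2) * (Real.pi : ℂ) ^ ((1 : ℂ) / 2) = Real.pi := by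
    rw [← Complex.cpow_add _ _ hp]
    norm_num
  rw [show -(ξ : ℂ) + 1 / 2 = 1 / 2 - ξ by ring, show 2 * -(ξ : ℂ) = -2 * ξ by ring, hsqrt,
    show 1 - -2 * (ξ : ℂ) = 1 - (-2 * (ξ : ℂ)) by ring,
    Complex.cpow_sub _ _ two_ne_zero, Complex.cpow_one] at hd
  have h2' : (2 : ℂ) ^ (-2 * (ξ : ℂ)) ≠ 0 := by simp [Complex.cpow_eq_zero_iff]
  have hsp : (Real.pi : ℂ) ^ ((1 : ℂ) / 2) ≠ 0 := by simp [Complex.cpow_eq_zero_iff, hp]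
  generalize (2 : ℂ) ^ (-2 * (ξ : ℂ)) = T at *
  generalize (Real.pi : ℂ) ^ ((1 : ℂ) / 2) = S at *
  generalize (Real.cos (Real.pi * ξ) : ℂ) = c at *
  generalize Complex.Gamma (-2 * (ξ : ℂ)) = G at *
  generalize Complex.Gamma (1 / 2 + (ξ : ℂ)) = G₂ at *
  generalize Complex.Gamma (1 / 2 - (ξ : ℂ)) = G₃ at *
  rw [← hs2] at hr
  field_simp at hd ⊢
  refine mul_left_cancel₀ hsp ?_
  linear_combination (-c * G₂) * hd + T * Complex.Gamma (-(ξ : ℂ)) * hr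

/-- for `ζ = ξ+iη` with `-1/2 < ξ < 0`, `η ≠ 0`, and `μ` odd, with
`c(ξ) = π^{1/2} 2^{-2ξ} Γ(-ξ)/Γ(1/2+ξ)`, the double integral converges absolutely and
`(1/c(ξ)) ∬ f_{ζ,μ}(t) f_{conj ζ,-μ}(u) |t-u|^{-2ξ-1} dt du
  = 2^{2ξ} Re[(Γ(1/2+conj ζ+μ/2)/Γ(1/2-ζ+μ/2))(1 + i tan(πξ) coth(πη))]`. -/
theorem stmt_16 (ξ η : ℝ) (h1 : -(1/2) < ξ) (h2 : ξ < 0) (hη : η ≠ 0) (ζ : ℂ)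
    (hζ : ζ = (ξ : ℂ) + (η : ℂ) * Complex.I) (μ : ℤ) (hμ : Odd μ) :
    Integrable (fun p : ℝ × ℝ =>
        fz ζ μ p.1 * fz ((starRingEnd ℂ) ζ) (-μ) p.2 *
          ((|p.1 - p.2| ^ (-2 * ξ - 1) : ℝ) : ℂ)) ∧
    ((1 / ((Real.pi : ℂ) ^ ((1:ℂ)/2) * (2 : ℂ) ^ (-2 * (ξ : ℂ)) * Complex.Gamma (-(ξ : ℂ)) /
          Complex.Gamma (1/2 + (ξ : ℂ)))) *
        ∫ p : ℝ × ℝ, fz ζ μ p.1 * fz ((starRingEnd ℂ) ζ) (-μ) p.2 *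
          ((|p.1 - p.2| ^ (-2 * ξ - 1) : ℝ) : ℂ))
      = (((2 : ℝ) ^ (2 * ξ) *
          (Complex.Gamma (1/2 + (starRingEnd ℂ) ζ + (μ : ℂ)/2) /
              Complex.Gamma (1/2 - ζ + (μ : ℂ)/2) *
            (1 + Complex.I * (Real.tan (Real.pi * ξ) : ℂ) *
              ((Real.cosh (Real.pi * η) / Real.sinh (Real.pi * η) : ℝ) : ℂ))).re : ℝ) : ℂ) := by
  refine ⟨integrable_fz_mul_fz_mul_abs_sub_rpow h2 hη hζ hμ, ?_⟩
  rw [integral_fz_mul_fz_mul_abs_sub_rpow h2 hη hζ hμ]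
  obtain ⟨m, rfl⟩ := hμ
  have hcos : Real.cos (Real.pi * ξ) ≠ 0 := by
    refine (Real.cos_pos_of_mem_Ioo ⟨?_, ?_⟩).ne' <;> nlinarith [Real.pi_pos]
  have hp : (Real.pi : ℂ) ≠ 0 := by exact_mod_cast Real.pi_ne_zero
  have hsinh : Complex.sinh (Real.pi * η) ≠ 0 := by
    rw [← Complex.ofReal_mul, ← Complex.ofReal_sinh, Complex.ofReal_ne_zero, Real.sinh_ne_zero]
    exact mul_ne_zero Real.pi_ne_zero hη
  have hB := Gamma_bracket_eq_re hη hζ hcos m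
  have hN := Gamma_neg_two_mul_mul_cos ξ h1 h2
  have hP : (Real.pi : ℂ) ^ (-(1/2) : ℂ) * (Real.pi : ℂ) ^ (-(1/2) : ℂ) * Real.pi = 1 := by
    rw [← Complex.cpow_add _ _ hp]
    norm_num [Complex.cpow_neg_one, hp]
  have h2pow : (((2 : ℝ) ^ (2 * ξ) : ℝ) : ℂ) = 2 ^ (2 * (ξ : ℂ)) := by
    rw [Complex.ofReal_cpow two_pos.le]
    push_cast
    rfl
  rw [integral_fz_mul_cpow_sub_cpow h2 hη hζ m,
    show 1 / 2 + (starRingEnd ℂ) ζ + ((2 * m + 1 : ℤ) : ℂ) / 2 = 1 + (starRingEnd ℂ) ζ + m by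
      push_cast; ring,
    show 1 / 2 - ζ + ((2 * m + 1 : ℤ) : ℂ) / 2 = 1 - ζ + m by push_cast; ring,
    Complex.ofReal_mul _ (Complex.re _), h2pow]
  generalize (((Complex.Gamma (1 + (starRingEnd ℂ) ζ + m) / Complex.Gamma (1 - ζ + m) *
          (1 + Complex.I * (Real.tan (Real.pi * ξ) : ℂ) *
            ((Real.cosh (Real.pi * η) / Real.sinh (Real.pi * η) : ℝ) : ℂ))).re : ℝ) : ℂ) = R at *
  rw [Complex.ofReal_sinh, Complex.ofReal_mul Real.pi η] at hB
  generalize Complex.sinh (Real.pi * η) = S at *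
  generalize 1 / ((Real.pi : ℂ) ^ ((1:ℂ)/2) * (2 : ℂ) ^ (-2 * (ξ : ℂ)) *
    Complex.Gamma (-(ξ : ℂ)) / Complex.Gamma (1/2 + (ξ : ℂ))) = N at *
  generalize (Real.pi : ℂ) ^ (-(1/2) : ℂ) = P at *
  generalize (Complex.Gamma (-(starRingEnd ℂ) ζ - m))⁻¹ * (Complex.Gamma (1 - ζ + m))⁻¹ -
    (Complex.Gamma (-ζ - m))⁻¹ * (Complex.Gamma (1 - (starRingEnd ℂ) ζ + m))⁻¹ = B at *
  generalize (2 : ℂ) ^ (2 * (ξ : ℂ)) = T at *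
  generalize Complex.Gamma (-2 * (ξ : ℂ)) = G at *
  trans N * (P * P * Real.pi) * (2 * S)⁻¹ * 2 * Real.pi * T * G *
    ((-Complex.I) ^ (2 * m + 1) * B)
  · ring
  · rw [hB, hP]
    field_simp
    linear_combination T * R * hN
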